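/- Let G be a random DAG on n vertices sampled from D(n,p), and fix a tower vector h=(h_1,...,h_s) of positive integers summing to n. Then the probability that h is the tower vector of G is proportional (with normalization independent of h) to w(h) = ( n choose h_1,...,h_s ) · ∏_{k=2}^{s} (1-(1-p)^{h_{k-1}})^{h_k} / (1-p)^{h_k·(h_1+...+h_{k-1})}, where (n choose h_1,...,h_s) denotes the multinomial coefficient. -/

import Mathlib

namespace CausalMEC

/-- A directed graph on `Fin n`, given by a Boolean edge function (`d a b = true` means `a → b`). -/
abbrev Dir (n : ℕ) := Fin n → Fin n → Bool

/-- Directed reachability (zero or more steps). -/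
def Reach {n : ℕ} (d : Dir n) : Fin n → Fin n → Prop :=
  Relation.ReflTransGen fun a b => d a b = true

/-- No directed cycles (including no self-loops). -/
def Acyclic {n : ℕ} (d : Dir n) : Prop :=
  ∀ v, ¬ Relation.TransGen (fun a b => d a b = true) v v

/-- A directed acyclic graph. -/
def IsDAG {n : ℕ} (d : Dir n) : Prop :=
  (∀ v, d v v = false) ∧ Acyclic d

/-- A directed (possibly cyclic) graph with edges between distinct vertices. -/
def IsDCG {n : ℕ} (d : Dir n) : Prop :=
  ∀ v, d v v = false

/-- The number of directed edges. -/
def edgeCount {n : ℕ} (d : Dir n) : ℕ :=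
  (Finset.univ.filter fun q : Fin n × Fin n => d q.1 q.2 = true).card

/-- The parent set of a vertex. -/
def parents {n : ℕ} (d : Dir n) (v : Fin n) : Finset (Fin n) :=
  Finset.univ.filter fun u => d u v = true

/-! ### Paths, d-connection and Markov equivalence in mixed graphs
A mixed graph is given by a directed part `d` and a bidirected part `b`. -/

/-- The kind of a step on a path: a directed edge traversed forwards, a directed edge
traversed backwards, or a bidirected edge. -/
inductive EdgeKind : Type
  | fwd | bwd | bidir
deriving DecidableEq

/-- Does the step point into its second endpoint? -/
def EdgeKind.intoSnd : EdgeKind → Bool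
  | .fwd => true
  | .bwd => false
  | .bidir => true

/-- Does the step point into its first endpoint? -/
def EdgeKind.intoFst : EdgeKind → Bool
  | .fwd => false
  | .bwd => true
  | .bidir => true

/-- A (possibly self-intersecting) path from `u` to `v` in the mixed graph `(d, b)`. -/
structure MPath {n : ℕ} (d b : Dir n) (u v : Fin n) where
  len : ℕ
  vert : Fin (len + 1) → Fin n
  kind : Fin len → EdgeKind
  first_eq : vert 0 = u
  last_eq : vert (Fin.last len) = v
  valid : ∀ i : Fin len,
    (kind i = .fwd → d (vert i.castSucc) (vert i.succ) = true) ∧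
    (kind i = .bwd → d (vert i.succ) (vert i.castSucc) = true) ∧
    (kind i = .bidir → b (vert i.castSucc) (vert i.succ) = true)

/-- Whether the internal vertex at position `i` of a path is a collider. -/
def MPath.colliderAt {n : ℕ} {d b : Dir n} {u v : Fin n} (π : MPath d b u v)
    (i : ℕ) (h1 : 0 < i) (h2 : i < π.len) : Bool :=
  (π.kind ⟨i - 1, by omega⟩).intoSnd && (π.kind ⟨i, h2⟩).intoFst

/-- A path is active given a conditioning set `Z` if every non-collider on it avoids `Z`
and every collider on it is in `Z` or has a descendant in `Z`. -/
def MPath.Active {n : ℕ} {d b : Dir n} {u v : Fin n} (π : MPath d b u v)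
    (Z : Finset (Fin n)) : Prop :=
  ∀ (i : ℕ) (h1 : 0 < i) (h2 : i < π.len),
    (π.colliderAt i h1 h2 = true →
      ∃ x ∈ Z, Reach d (π.vert ⟨i, by omega⟩) x) ∧
    (π.colliderAt i h1 h2 = false →
      π.vert ⟨i, by omega⟩ ∉ Z)

/-- d-connection given a conditioning set. -/
def DConn {n : ℕ} (d b : Dir n) (u v : Fin n) (Z : Finset (Fin n)) : Prop :=
  ∃ π : MPath d b u v, π.Active Z

/-- Markov equivalence of two mixed graphs: the same d-connection relations. -/
def MarkovEquiv {n : ℕ} (d b d' b' : Dir n) : Prop :=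
  ∀ (u v : Fin n) (Z : Finset (Fin n)), u ≠ v → u ∉ Z → v ∉ Z →
    (DConn d b u v Z ↔ DConn d' b' u v Z)

/-- The empty bidirected part: a purely directed graph. -/
def noBi (n : ℕ) : Dir n := fun _ _ => false

/-- Markov equivalence for purely directed graphs. -/
def MarkovEquivD {n : ℕ} (d d' : Dir n) : Prop :=
  MarkovEquiv d (noBi n) d' (noBi n)

/-- The Markov equivalence class of a DAG (within DAGs). -/
def MECdag {n : ℕ} (d : Dir n) : Set (Dir n) :=
  {d' | IsDAG d' ∧ MarkovEquivD d d'}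

/-- An acyclic directed mixed graph. -/
def IsADMG {n : ℕ} (d b : Dir n) : Prop :=
  IsDAG d ∧ (∀ v w, b v w = b w v) ∧ (∀ v, b v v = false)

/-- The Markov equivalence class of an ADMG (within ADMGs). -/
def MECadmg {n : ℕ} (d b : Dir n) : Set (Dir n × Dir n) :=
  {G | IsADMG G.1 G.2 ∧ MarkovEquiv d b G.1 G.2}

/-- The Markov equivalence class of a DCG (within DCGs). -/
def MECdcg {n : ℕ} (d : Dir n) : Set (Dir n) :=
  {d' | IsDCG d' ∧ MarkovEquivD d d'}

/-! ### The distribution `D(n,p)` and uniform ADMGs/DCGs -/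

/-- The (unnormalized) weight of a DAG under `D(n,p)`. -/
noncomputable def dagWeight {n : ℕ} (p : ℝ) (d : Dir n) : ℝ :=
  (p / (1 - p)) ^ edgeCount d

open scoped Classical in
/-- Probability of the event `A` under `D(n,p)`. -/
noncomputable def prD (n : ℕ) (p : ℝ) (A : Dir n → Prop) : ℝ :=
  (∑ d : Dir n, if IsDAG d ∧ A d then dagWeight p d else 0) /
    (∑ d : Dir n, if IsDAG d then dagWeight p d else 0)

open scoped Classical in
/-- Expectation of `f` under `D(n,p)`. -/
noncomputable def expD (n : ℕ) (p : ℝ) (f : Dir n → ℝ) : ℝ :=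
  (∑ d : Dir n, if IsDAG d then f d * dagWeight p d else 0) /
    (∑ d : Dir n, if IsDAG d then dagWeight p d else 0)

/-- Conditional probability of `A` given `B` under `D(n,p)`. -/
noncomputable def condPrD (n : ℕ) (p : ℝ) (A B : Dir n → Prop) : ℝ :=
  prD n p (fun d => A d ∧ B d) / prD n p B

open scoped Classical in
/-- Expectation of `f` under the uniform distribution on ADMGs on `n` vertices. -/
noncomputable def expADMG (n : ℕ) (f : Dir n × Dir n → ℝ) : ℝ :=
  (∑ G : Dir n × Dir n, if IsADMG G.1 G.2 then f G else 0) /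
    (∑ G : Dir n × Dir n, if IsADMG G.1 G.2 then (1 : ℝ) else 0)

open scoped Classical in
/-- Expectation of `f` under the uniform distribution on DCGs on `n` vertices. -/
noncomputable def expDCG (n : ℕ) (f : Dir n → ℝ) : ℝ :=
  (∑ d : Dir n, if IsDCG d then f d else 0) /
    (∑ d : Dir n, if IsDCG d then (1 : ℝ) else 0)

open scoped Classical in
/-- Probability of the event `A` under the uniform distribution on DCGs on `n` vertices. -/
noncomputable def prDCG (n : ℕ) (A : Dir n → Prop) : ℝ :=
  (∑ d : Dir n, if IsDCG d ∧ A d then (1 : ℝ) else 0) /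
    (∑ d : Dir n, if IsDCG d then (1 : ℝ) else 0)

/-! ### Tower decomposition -/

/-- The sources of `d` within a vertex set `S` (no parents inside `S`). -/
def sourcesIn {n : ℕ} (d : Dir n) (S : Finset (Fin n)) : Finset (Fin n) :=
  S.filter fun v => ∀ u ∈ S, d u v = false

/-- The vertices remaining after peeling off `k` layers of sources. -/
def remaining {n : ℕ} (d : Dir n) : ℕ → Finset (Fin n)
  | 0 => Finset.univ
  | k + 1 => remaining d k \ sourcesIn d (remaining d k)

/-- The `i`-th layer (1-based) of the tower decomposition of `d`. -/
def towerLayer {n : ℕ} (d : Dir n) (i : ℕ) : Finset (Fin n) :=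
  sourcesIn d (remaining d (i - 1))

/-- The 1-based index of the layer containing `v`. -/
def layerIdx {n : ℕ} (d : Dir n) (v : Fin n) : ℕ :=
  ((Finset.range n).filter fun j => v ∈ remaining d j).card

/-- The tower of a DAG: only the edges between adjacent layers are kept. -/
def tower {n : ℕ} (d : Dir n) : Dir n :=
  fun a c => d a c && decide (layerIdx d c = layerIdx d a + 1)

/-- `h` is the tower vector of `d` (layer sizes, 1-based, and no further layers). -/
def hasTowerVector {n : ℕ} (d : Dir n) (h : List ℕ) : Prop :=
  (∀ i : Fin h.length, (towerLayer d (i.val + 1)).card = h.get i) ∧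
    towerLayer d (h.length + 1) = ∅

/-- `H` is the tower decomposition of `d`. -/
def hasTowerDecomp {n : ℕ} (d : Dir n) (H : List (Finset (Fin n))) : Prop :=
  (∀ i : Fin H.length, towerLayer d (i.val + 1) = H.get i) ∧
    towerLayer d (H.length + 1) = ∅

/-- The weight `w(h)` of a tower vector `h = (h_1, …, h_s)`. -/
noncomputable def towerWeight (p : ℝ) (h : List ℕ) : ℝ :=
  (Nat.multinomial Finset.univ (fun i : Fin h.length => h.get i) : ℝ) *
    ∏ k ∈ Finset.Icc 2 h.length,
      (1 - (1 - p) ^ h.getD (k - 2) 0) ^ h.getD (k - 1) 0 /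
        (1 - p) ^ (h.getD (k - 1) 0 * ∑ i ∈ Finset.range (k - 1), h.getD i 0)

/-! ### Edge reversal and deletion -/

/-- Reverse the edge `v → w`. -/
def reverseEdge {n : ℕ} (d : Dir n) (v w : Fin n) : Dir n :=
  fun a c => if a = v ∧ c = w then false else if a = w ∧ c = v then true else d a c

/-- Delete the edge `v → w`. -/
def deleteEdge {n : ℕ} (d : Dir n) (v w : Fin n) : Dir n :=
  fun a c => if a = v ∧ c = w then false else d a c

/-- The edge `v → w` of a DAG is reversible: reversing it yields a Markov-equivalent DAG. -/
def Reversible {n : ℕ} (d : Dir n) (v w : Fin n) : Prop :=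
  d v w = true ∧ IsDAG (reverseEdge d v w) ∧ MarkovEquivD d (reverseEdge d v w)

/-- `d` has a matching of reversible layer-2-edges of size at least `m`. -/
def hasRevL2Matching {n : ℕ} (d : Dir n) (m : ℝ) : Prop :=
  ∃ S : Finset (Fin n × Fin n),
    (∀ e ∈ S, Reversible d e.1 e.2 ∧ e.2 ∈ towerLayer d 2) ∧
    (∀ e ∈ S, ∀ e' ∈ S, e ≠ e' →
      e.1 ≠ e'.1 ∧ e.1 ≠ e'.2 ∧ e.2 ≠ e'.1 ∧ e.2 ≠ e'.2) ∧
    m ≤ (S.card : ℝ)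

/-! ### Cycles and the `Reverse` construction -/

/-- Cyclic successor in `Fin k`. -/
def cycSucc {k : ℕ} (i : Fin k) : Fin k :=
  ⟨(i.val + 1) % k, Nat.mod_lt _ i.pos⟩

/-- The reversed parametrization of a cycle. -/
def cycRev {n k : ℕ} (c : Fin k → Fin n) : Fin k → Fin n :=
  fun i => c ⟨(k - i.val) % k, Nat.mod_lt _ i.pos⟩

/-- `c` lists the (distinct) vertices of a directed cycle of `d`, in order. -/
def IsCycle {n k : ℕ} (d : Dir n) (c : Fin k → Fin n) : Prop :=
  Function.Injective c ∧ ∀ i, d (c i) (c (cycSucc i)) = true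

/-- The `Reverse(G, C)` construction: reverse the cycle `c` and redirect every edge
`w → v_i` with `w ∈ Pa(v_i) \ {v_{i-1}}` to `w → v_{i-1}`. -/
def reverseCycle {n k : ℕ} (d : Dir n) (c : Fin k → Fin n) : Dir n :=
  fun a e =>
    decide ((∃ j : Fin k, e = c j ∧
        (a = c (cycSucc j) ∨ (d a (c (cycSucc j)) = true ∧ a ≠ c j))) ∨
      ((∀ j : Fin k, e ≠ c j) ∧ d a e = true))

/-- A vertex triple induces exactly a directed 3-cycle. -/
def induces3Cycle {n : ℕ} (d : Dir n) (W : Finset (Fin n)) : Prop :=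
  ∃ a b c : Fin n, W = {a, b, c} ∧ a ≠ b ∧ a ≠ c ∧ b ≠ c ∧
    d a b = true ∧ d b c = true ∧ d c a = true ∧
    d b a = false ∧ d c b = false ∧ d a c = false

/-- The number of maps with prescribed fibre sizes is a multinomial coefficient. -/
theorem card_filter_fiber_card_eq_multinomial {σ : Type*} [Fintype σ] [DecidableEq σ] {n : ℕ}
    (k : σ → ℕ) (hk : ∑ i, k i = n) :
    (Finset.univ.filter fun f : Fin n → σ =>
      ∀ i, (Finset.univ.filter fun v => f v = i).card = k i).card =
      Nat.multinomial Finset.univ k := by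
  have key := MvPolynomial.coeff_sum_X_pow_of_fintype (R := ℕ) (Finsupp.equivFunOnFinite.symm k) n
  have hsum : (Finsupp.equivFunOnFinite.symm k).sum (fun _ m => m) = n := by
    rw [Finsupp.sum_fintype _ _ (fun _ => rfl)]
    simpa using hk
  rw [if_pos hsum, ← Finsupp.multinomial_of_support_subset (Finset.subset_univ _),
    Finset.sum_pow', MvPolynomial.coeff_sum, Fintype.piFinset_univ] at key
  rw [Finset.card_filter]
  refine Eq.trans (Finset.sum_congr rfl fun f _ => ?_) (key.trans (by simp))
  have hprod : ∏ v, (MvPolynomial.X (f v) : MvPolynomial σ ℕ) =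
      MvPolynomial.monomial (∑ v, Finsupp.single (f v) 1) 1 := by
    rw [MvPolynomial.monomial_sum_one]
    rfl
  rw [hprod, MvPolynomial.coeff_monomial]
  refine if_congr ?_ rfl rfl
  rw [Finsupp.ext_iff]
  refine forall_congr' fun i => ?_
  simp [Finsupp.finsetSum_apply, Finsupp.single_apply]

open scoped Classical in
theorem sum_indicator_supported {α : Type*} [Fintype α] (x : ℝ) (L : Finset α) :
    (∑ c : α → Bool, if ∀ u, c u = true → u ∈ L then ∏ u, (if c u = true then x else 1) else 0) =
      (x + 1) ^ L.card := by
  have hterm : ∀ c : α → Bool,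
      (if ∀ u, c u = true → u ∈ L then ∏ u, (if c u = true then x else 1) else 0) =
        ∏ u, (if c u = true then (if u ∈ L then x else 0) else 1) := by
    intro c
    split_ifs with hc
    · refine Finset.prod_congr rfl fun u _ => ?_
      by_cases hu : c u = true
      · simp [hu, hc u hu]
      · simp [hu]
    · push Not at hc
      obtain ⟨u, hu, huL⟩ := hc
      exact (Finset.prod_eq_zero (Finset.mem_univ u) (by simp [hu, huL])).symm
  rw [Finset.sum_congr rfl fun c _ => hterm c,
    ← Fintype.prod_sum fun u (b : Bool) => if b = true then (if u ∈ L then x else 0) else (1 : ℝ)]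
  have hfac : ∀ u, (∑ b : Bool, if b = true then (if u ∈ L then x else 0) else (1 : ℝ)) =
      if u ∈ L then x + 1 else 1 := by
    intro u
    by_cases hu : u ∈ L <;> simp [hu]
  simp_rw [hfac]
  simp

open scoped Classical in
theorem sum_indicator_supported_not_supported {α : Type*} [Fintype α] (x : ℝ) {B L : Finset α}
    (hBL : B ⊆ L) :
    (∑ c : α → Bool, if (∀ u, c u = true → u ∈ L) ∧ ∃ u, c u = true ∧ u ∉ B then
      ∏ u, (if c u = true then x else 1) else 0) = (x + 1) ^ L.card - (x + 1) ^ B.card := by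
  rw [← sum_indicator_supported x L, ← sum_indicator_supported x B, ← Finset.sum_sub_distrib]
  refine Finset.sum_congr rfl fun c _ => ?_
  by_cases hB : ∀ u, c u = true → u ∈ B
  · have hL : ∀ u, c u = true → u ∈ L := fun u hu => hBL (hB u hu)
    have hn : ¬ ∃ u, c u = true ∧ u ∉ B := fun ⟨u, hu, huB⟩ => huB (hB u hu)
    simp only [if_pos hB, if_pos hL, hn, and_false, if_false, sub_self]
  · have he : ∃ u, c u = true ∧ u ∉ B := by
      push Not at hB
      exact hB
    simp only [if_neg hB, he, and_true, sub_zero]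

/-- `f` assigns to each vertex of `d` its 0-based layer: edges strictly increase `f`, and every
vertex outside layer `0` has a parent in the previous layer. -/
def IsLayering {n : ℕ} (d : Dir n) (f : Fin n → ℕ) : Prop :=
  ∀ v, (∀ u, d u v = true → f u < f v) ∧ (f v ≠ 0 → ∃ u, d u v = true ∧ f u + 1 = f v)

theorem IsLayering.isDAG {n : ℕ} {d : Dir n} {f : Fin n → ℕ} (hf : IsLayering d f) : IsDAG d := by
  refine ⟨fun v => ?_, fun v hv => ?_⟩
  · by_contra h
    exact lt_irrefl _ ((hf v).1 v (by simpa using h))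
  · have hlt : ∀ a b, Relation.TransGen (fun a b => d a b = true) a b → f a < f b := by
      intro a b hab
      induction hab with
      | single h => exact (hf _).1 _ h
      | tail _ h ih => exact ih.trans ((hf _).1 _ h)
    exact lt_irrefl _ (hlt v v hv)

theorem IsLayering.sourcesIn_filter {n : ℕ} {d : Dir n} {f : Fin n → ℕ} (hf : IsLayering d f)
    (k : ℕ) : sourcesIn d (Finset.univ.filter fun v => k ≤ f v) =
      Finset.univ.filter fun v => f v = k := by
  ext v
  simp only [sourcesIn, Finset.mem_filter, Finset.mem_univ, true_and]
  constructor
  · rintro ⟨hk, hs⟩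
    by_contra hne
    obtain ⟨u, hu, huv⟩ := (hf v).2 (by omega)
    simp [hs u (by omega)] at hu
  · rintro rfl
    refine ⟨le_rfl, fun u hu => ?_⟩
    by_contra h
    exact absurd ((hf v).1 u (by simpa using h)) (by omega)

theorem IsLayering.remaining_eq {n : ℕ} {d : Dir n} {f : Fin n → ℕ} (hf : IsLayering d f)
    (k : ℕ) : remaining d k = Finset.univ.filter fun v => k ≤ f v := by
  induction k with
  | zero => simp [remaining]
  | succ k ih =>
    rw [remaining, ih, hf.sourcesIn_filter]
    ext v
    simp only [Finset.mem_sdiff, Finset.mem_filter, Finset.mem_univ, true_and]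
    omega

theorem IsLayering.towerLayer_succ {n : ℕ} {d : Dir n} {f : Fin n → ℕ} (hf : IsLayering d f)
    (k : ℕ) : towerLayer d (k + 1) = Finset.univ.filter fun v => f v = k := by
  rw [towerLayer, Nat.add_sub_cancel, hf.remaining_eq, hf.sourcesIn_filter]

theorem IsLayering.unique {n : ℕ} {d : Dir n} {f g : Fin n → ℕ} (hf : IsLayering d f)
    (hg : IsLayering d g) : f = g := by
  funext v
  have h : v ∈ towerLayer d (f v + 1) := by simp [hf.towerLayer_succ]
  rw [hg.towerLayer_succ] at h
  exact (Finset.mem_filter.1 h).2.symm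

theorem remaining_antitone {n : ℕ} (d : Dir n) : Antitone (remaining d) :=
  antitone_nat_of_succ_le fun _ => Finset.sdiff_subset

theorem mem_remaining_succ {n : ℕ} {d : Dir n} {k : ℕ} {v : Fin n} :
    v ∈ remaining d (k + 1) ↔ v ∈ remaining d k ∧ ∃ u ∈ remaining d k, d u v = true := by
  simp only [remaining, sourcesIn, Finset.mem_sdiff, Finset.mem_filter, not_and, not_forall,
    Bool.not_eq_false, exists_prop]
  exact and_congr_right fun hv => ⟨fun h => h hv, fun h _ => h⟩

theorem exists_isLayering {n : ℕ} {d : Dir n} {s : ℕ} (hs : remaining d s = ∅) :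
    ∃ f : Fin n → ℕ, (∀ v, f v < s) ∧ IsLayering d f := by
  obtain ⟨f, hmem⟩ : ∃ f : Fin n → ℕ, ∀ v k, v ∈ remaining d k ↔ k ≤ f v := by
    have hex : ∀ v : Fin n, ∃ k, v ∉ remaining d (k + 1) := fun v =>
      ⟨s, fun h => by simpa [hs] using remaining_antitone d s.le_succ h⟩
    refine ⟨fun v => Nat.find (hex v), fun v k => ⟨fun h => ?_, fun h => ?_⟩⟩
    · by_contra hlt
      exact Nat.find_spec (hex v) (remaining_antitone d (not_le.mp hlt) h)
    · cases k with
      | zero => simp [remaining]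
      | succ k => exact not_not.mp (Nat.find_min (hex v) h)
  refine ⟨f, fun v => ?_, fun v => ⟨fun u hu => ?_, fun h0 => ?_⟩⟩
  · by_contra h
    simpa [hs] using (hmem v s).2 (by simpa using h)
  · by_contra hlt
    have h : v ∈ remaining d (f v + 1) :=
      mem_remaining_succ.2 ⟨(hmem v _).2 le_rfl, u, (hmem u _).2 (by omega), hu⟩
    have := (hmem v _).1 h
    omega
  · obtain ⟨k, hk⟩ := Nat.exists_eq_succ_of_ne_zero h0
    obtain ⟨-, u, hu, hd⟩ := mem_remaining_succ.1 ((hmem v (k + 1)).2 hk.ge)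
    refine ⟨u, hd, ?_⟩
    have hku := (hmem u k).1 hu
    by_contra hne
    have h : v ∈ remaining d (f v + 1) :=
      mem_remaining_succ.2 ⟨(hmem v _).2 le_rfl, u, (hmem u _).2 (by omega), hd⟩
    have := (hmem v _).1 h
    omega

theorem card_remaining_add_sum {n : ℕ} {d : Dir n} {h : List ℕ} (hd : hasTowerVector d h) :
    ∀ k ≤ h.length, (remaining d k).card + (h.take k).sum = n := by
  intro k
  induction k with
  | zero => simp [remaining]
  | succ k ih =>
    intro hk
    have h1 := ih (by omega)
    have h2 := hd.1 ⟨k, hk⟩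
    simp only [towerLayer, Nat.add_sub_cancel, List.get_eq_getElem] at h2
    have hsub : sourcesIn d (remaining d k) ⊆ remaining d k := Finset.filter_subset _ _
    have h3 := Finset.card_sdiff_add_card_eq_card hsub
    rw [List.sum_take_succ _ _ hk, remaining]
    omega

theorem hasTowerVector_iff_exists_isLayering {n : ℕ} {d : Dir n} {h : List ℕ} (hn : h.sum = n) :
    hasTowerVector d h ↔ ∃ f : Fin n → Fin h.length,
      (∀ i, (Finset.univ.filter fun v => f v = i).card = h.get i) ∧
        IsLayering d fun v => (f v : ℕ) := by
  constructor
  · intro hd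
    have hrem := card_remaining_add_sum hd h.length le_rfl
    rw [List.take_length] at hrem
    obtain ⟨f, hfs, hf⟩ := exists_isLayering (Finset.card_eq_zero.mp (by omega :
      (remaining d h.length).card = 0))
    refine ⟨fun v => ⟨f v, hfs v⟩, fun i => ?_, hf⟩
    rw [← hd.1 i, hf.towerLayer_succ]
    simp [Fin.ext_iff]
  · rintro ⟨f, hcard, hf⟩
    refine ⟨fun i => ?_, ?_⟩
    · rw [← hcard i, hf.towerLayer_succ]
      simp [Fin.ext_iff]
    · rw [hf.towerLayer_succ]
      ext v
      simpa using (f v).isLt.ne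

theorem pow_edgeCount_eq_prod {n : ℕ} (x : ℝ) (d : Dir n) :
    x ^ edgeCount d = ∏ v, ∏ u, if d u v = true then x else 1 := by
  rw [← Fintype.prod_prod_type_right' fun u v => if d u v = true then x else 1]
  simp [edgeCount, Finset.prod_ite]

/-- The total weight of the possible parent sets of a vertex in 0-based layer `j`, where the layer
sizes are given by `k`. -/
def parentWeight (x : ℝ) (k : ℕ → ℕ) : ℕ → ℝ
  | 0 => 1
  | j + 1 => (x + 1) ^ (∑ i ∈ Finset.range (j + 1), k i) - (x + 1) ^ (∑ i ∈ Finset.range j, k i)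

theorem card_filter_lt_eq_sum {α : Type*} [Fintype α] {f : α → ℕ} {k : ℕ → ℕ}
    (hk : ∀ i, (Finset.univ.filter fun v => f v = i).card = k i) (m : ℕ) :
    (Finset.univ.filter fun v => f v < m).card = ∑ i ∈ Finset.range m, k i := by
  rw [Finset.card_eq_sum_card_fiberwise (f := f) (t := Finset.range m)
    (fun v hv => by simpa using hv)]
  refine Finset.sum_congr rfl fun i hi => ?_
  rw [← hk i, Finset.filter_filter]
  congr 1
  ext v
  simp only [Finset.mem_filter, Finset.mem_univ, true_and, Finset.mem_range] at hi ⊢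
  omega

open scoped Classical in
theorem sum_parent_indicator {α : Type*} [Fintype α] (x : ℝ) {f : α → ℕ} {k : ℕ → ℕ}
    (hk : ∀ i, (Finset.univ.filter fun v => f v = i).card = k i) (j : ℕ) :
    (∑ c : α → Bool, if (∀ u, c u = true → f u < j) ∧ (j ≠ 0 → ∃ u, c u = true ∧ f u + 1 = j) then
      ∏ u, (if c u = true then x else 1) else 0) = parentWeight x k j := by
  cases j with
  | zero =>
    have := sum_indicator_supported x (∅ : Finset α)
    simpa [parentWeight] using this
  | succ j =>
    rw [parentWeight, ← card_filter_lt_eq_sum hk, ← card_filter_lt_eq_sum hk,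
      ← sum_indicator_supported_not_supported x
        (Finset.monotone_filter_right _ fun v _ hv => Nat.lt_succ_of_lt hv)]
    refine Finset.sum_congr rfl fun c _ => if_congr ?_ rfl rfl
    simp only [Finset.mem_filter, Finset.mem_univ, true_and, ne_eq, Nat.succ_ne_zero,
      not_false_eq_true, forall_const]
    refine and_congr_right fun hc => exists_congr fun u => and_congr_right fun hu => ?_
    have := hc u hu
    omega

open scoped Classical in
theorem sum_isLayering_pow_edgeCount {n : ℕ} (x : ℝ) {f : Fin n → ℕ} {k : ℕ → ℕ}
    (hk : ∀ i, (Finset.univ.filter fun v => f v = i).card = k i) :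
    (∑ d : Dir n, if IsLayering d f then x ^ edgeCount d else 0) =
      ∏ v, parentWeight x k (f v) := by
  have hparent : ∀ v, parentWeight x k (f v) = ∑ c : Fin n → Bool,
      if (∀ u, c u = true → f u < f v) ∧ (f v ≠ 0 → ∃ u, c u = true ∧ f u + 1 = f v) then
        ∏ u, (if c u = true then x else 1) else 0 := by
    intro v
    rw [← sum_parent_indicator x hk]
    congr!
  rw [Finset.prod_congr rfl fun v _ => hparent v, Fintype.prod_sum]
  refine Fintype.sum_equiv (Equiv.piComm _) _ _ fun d => ?_
  rw [pow_edgeCount_eq_prod, Finset.prod_ite_zero]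
  by_cases hd : IsLayering d f
  · rw [if_pos hd]
    exact (if_pos fun v _ => hd v).symm
  · rw [if_neg hd]
    exact (if_neg fun h => hd fun v => h v (Finset.mem_univ v)).symm

theorem prod_parentWeight_eq {p : ℝ} (hp1 : p < 1) (h : List ℕ) :
    ∏ j ∈ Finset.range h.length, parentWeight (p / (1 - p)) (fun i => h.getD i 0) j ^ h.getD j 0 =
      ∏ k ∈ Finset.Icc 2 h.length,
        (1 - (1 - p) ^ h.getD (k - 2) 0) ^ h.getD (k - 1) 0 /
          (1 - p) ^ (h.getD (k - 1) 0 * ∑ i ∈ Finset.range (k - 1), h.getD i 0) := by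
  have hq : 1 - p ≠ 0 := by linarith
  have hx : p / (1 - p) + 1 = (1 - p)⁻¹ := by
    field_simp
    ring
  rcases hs : h.length with _ | t
  · simp
  · rw [Finset.prod_range_succ', show Finset.Icc 2 (t + 1) = Finset.Ico 2 (t + 2) from rfl,
      Finset.prod_Ico_eq_prod_range]
    simp only [parentWeight, one_pow, mul_one, Nat.add_sub_cancel]
    refine Finset.prod_congr rfl fun i _ => ?_
    rw [show 2 + i - 2 = i by omega, show 2 + i - 1 = i + 1 by omega, hx, mul_comm (h.getD _ _),
      pow_mul, ← div_pow, Finset.sum_range_succ]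
    congr 1
    rw [pow_add, pow_add, inv_pow, inv_pow]
    field_simp

theorem sum_dagWeight_pos (n : ℕ) {p : ℝ} (hp0 : 0 ≤ p) (hp1 : p < 1) :
    open scoped Classical in 0 < ∑ d : Dir n, if IsDAG d then dagWeight p d else 0 := by
  classical
  refine Finset.sum_pos' (fun d _ => ?_) ⟨fun _ _ => false, Finset.mem_univ _, ?_⟩
  · split_ifs
    · exact pow_nonneg (div_nonneg hp0 (by linarith)) _
    · exact le_rfl
  · have hdag : IsDAG (fun _ _ => false : Dir n) :=
      IsLayering.isDAG (f := fun _ => 0) fun v => by simp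
    simp [hdag, dagWeight, edgeCount]

open scoped Classical in
theorem sum_dagWeight_hasTowerVector {n : ℕ} {p : ℝ} (hp1 : p < 1) {h : List ℕ} (hn : h.sum = n) :
    (∑ d : Dir n, if IsDAG d ∧ hasTowerVector d h then dagWeight p d else 0) =
      towerWeight p h := by
  set F := Finset.univ.filter fun f : Fin n → Fin h.length =>
    ∀ i, (Finset.univ.filter fun v => f v = i).card = h.get i with hF
  have hterm : ∀ d : Dir n, (if IsDAG d ∧ hasTowerVector d h then dagWeight p d else 0) =
      ∑ f ∈ F, if IsLayering d (fun v => (f v : ℕ)) then dagWeight p d else 0 := by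
    intro d
    by_cases hd : hasTowerVector d h
    · obtain ⟨f, hcard, hf⟩ := (hasTowerVector_iff_exists_isLayering hn).1 hd
      rw [if_pos ⟨hf.isDAG, hd⟩, Finset.sum_eq_single f, if_pos hf]
      · intro g _ hgf
        refine if_neg fun hg => hgf ?_
        funext v
        exact Fin.ext (congrFun (hg.unique hf) v)
      · intro hmem
        exact absurd (by simpa [hF] using hcard) hmem
    · rw [if_neg fun hd' => hd hd'.2]
      refine (Finset.sum_eq_zero fun f hfF => if_neg fun hf => hd ?_).symm
      exact (hasTowerVector_iff_exists_isLayering hn).2 ⟨f, (Finset.mem_filter.1 hfF).2, hf⟩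
  have hfiber : ∀ f ∈ F,
      (∑ d : Dir n, if IsLayering d (fun v => (f v : ℕ)) then dagWeight p d else 0) =
        ∏ j ∈ Finset.range h.length,
          parentWeight (p / (1 - p)) (fun i => h.getD i 0) j ^ h.getD j 0 := by
    intro f hfF
    have hcard := (Finset.mem_filter.1 hfF).2
    have hk : ∀ i, (Finset.univ.filter fun v => (f v : ℕ) = i).card = h.getD i 0 := by
      intro i
      by_cases hi : i < h.length
      · have := hcard ⟨i, hi⟩
        simpa [Fin.ext_iff, hi] using this
      · rw [List.getD_eq_default _ _ (by omega), Finset.card_eq_zero, Finset.filter_eq_empty_iff]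
        intro v _
        have := (f v).isLt
        omega
    simp only [dagWeight]
    rw [sum_isLayering_pow_edgeCount _ hk, ← Finset.prod_fiberwise_of_maps_to'
      (t := Finset.range h.length) (g := fun v => (f v : ℕ)) (fun v _ => by simp)]
    refine Finset.prod_congr rfl fun j _ => ?_
    rw [Finset.prod_const, hk]
  have hmult : F.card = Nat.multinomial Finset.univ fun i : Fin h.length => h.get i := by
    rw [← card_filter_fiber_card_eq_multinomial (fun i : Fin h.length => h.get i)
      (by simpa [Fin.sum_univ_getElem] using hn), hF]
    congr!
  rw [Finset.sum_congr rfl fun d _ => hterm d, Finset.sum_comm, Finset.sum_congr rfl hfiber,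
    Finset.sum_const, nsmul_eq_mul, hmult, prod_parentWeight_eq hp1, towerWeight]

/-- Lemma 2.2(a): under `D(n,p)`, the probability that `h` is the tower
vector of `G` is proportional to `w(h)`, with normalization independent of `h`. -/
theorem tower_vector_distribution (n : ℕ) (p : ℝ) (hp0 : 0 ≤ p) (hp1 : p < 1) :
    ∃ Z : ℝ, 0 < Z ∧
      ∀ h : List ℕ, (∀ x ∈ h, 0 < x) → h.sum = n →
        prD n p (fun d => hasTowerVector d h) = towerWeight p h / Z := by
  exact ⟨_, sum_dagWeight_pos n hp0 hp1, fun h _ hn => by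
    rw [prD, sum_dagWeight_hasTowerVector hp1 hn]⟩

end CausalMEC
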